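/- arXiv:1810.10825 — 9 statements merged into one kernel-verified Lean document; each statement's English description precedes it below -/
import Mathlib

section
/- For all vectors v₁ = (a₁, b₁) and v₂ = (a₂, b₂) in ℍ one has L(v₁ + v₂) ≤ L(v₁) + L(v₂); moreover L(k·v) = k·L(v) for every v ∈ ℍ and every real k > 0. -/
/-- The function `L` on the upper half plane `ℍ = ℝ × ℝ_{>0}`:
`L(a,b) = (3/2)b + a` if `a/b ≥ -1`, and `L(a,b) = -b²/(2a)` if `a/b ≤ -1`. -/
noncomputable def L (v : ℝ × ℝ) : ℝ :=
  if -1 ≤ v.1 / v.2 then 3 / 2 * v.2 + v.1 else -v.2 ^ 2 / (2 * v.1)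

theorem L_eq_of_neg_le {a b : ℝ} (hb : 0 < b) (h : -b ≤ a) : L (a, b) = 3 / 2 * b + a := by
  have h' : -1 ≤ a / b := by rw [le_div_iff₀ hb]; linarith
  simp [L, h']

theorem L_eq_of_lt_neg {a b : ℝ} (hb : 0 < b) (h : a < -b) : L (a, b) = -b ^ 2 / (2 * a) := by
  have h' : ¬ -1 ≤ a / b := by rw [not_le, div_lt_iff₀ hb]; linarith
  simp [L, h']

theorem linear_le_L {a b : ℝ} (hb : 0 < b) : 3 / 2 * b + a ≤ L (a, b) := by
  rcases le_or_gt (-b) a with h | h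
  · rw [L_eq_of_neg_le hb h]
  · rw [L_eq_of_lt_neg hb h, le_div_iff_of_neg (by linarith)]
    nlinarith [mul_pos (show 0 < -a - b by linarith) (show 0 < -2 * a - b by linarith)]

/-- The tangent lines of `t ↦ L (t, 1)` at the points `t = -1 / u` lie below `L`. -/
theorem tangent_le_L {a b u : ℝ} (hb : 0 < b) (hu₀ : 0 ≤ u) (hu₁ : u ≤ 1) :
    u * b + u ^ 2 / 2 * a ≤ L (a, b) := by
  rcases le_or_gt (-b) a with h | h
  · rw [L_eq_of_neg_le hb h]
    nlinarith [mul_nonneg (show 0 ≤ 1 - u ^ 2 / 2 by nlinarith) (show 0 ≤ a + b by linarith),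
      mul_nonneg hb.le (sq_nonneg (1 - u))]
  · rw [L_eq_of_lt_neg hb h, le_div_iff_of_neg (by linarith)]
    nlinarith [sq_nonneg (u * a + b)]

theorem L_add_le {a₁ b₁ a₂ b₂ : ℝ} (h₁ : 0 < b₁) (h₂ : 0 < b₂) :
    L (a₁ + a₂, b₁ + b₂) ≤ L (a₁, b₁) + L (a₂, b₂) := by
  have hb : 0 < b₁ + b₂ := add_pos h₁ h₂
  rcases le_or_gt (-(b₁ + b₂)) (a₁ + a₂) with h | h
  · rw [L_eq_of_neg_le hb h]
    linarith [linear_le_L (a := a₁) h₁, linear_le_L (a := a₂) h₂]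
  · have ha : a₁ + a₂ < 0 := by linarith
    set u := -(b₁ + b₂) / (a₁ + a₂) with hu
    have hu₀ : 0 ≤ u := div_nonneg_of_nonpos (by linarith) ha.le
    have hu₁ : u ≤ 1 := by rw [hu, div_le_iff_of_neg ha]; linarith
    have key : L (a₁ + a₂, b₁ + b₂) = u * (b₁ + b₂) + u ^ 2 / 2 * (a₁ + a₂) := by
      rw [L_eq_of_lt_neg hb h, hu]
      field_simp [ha.ne]
      ring
    rw [key]
    linarith [tangent_le_L (a := a₁) h₁ hu₀ hu₁, tangent_le_L (a := a₂) h₂ hu₀ hu₁]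

theorem L_mul_mul {a b k : ℝ} (hk : 0 < k) : L (k * a, k * b) = k * L (a, b) := by
  simp only [L, mul_div_mul_left a b hk.ne']
  split_ifs
  · ring
  · rw [show -(k * b) ^ 2 = k * (k * -b ^ 2) by ring, show 2 * (k * a) = k * (2 * a) by ring,
      mul_div_assoc, mul_div_mul_left _ _ hk.ne']

/-- For all `v₁ = (a₁,b₁)`, `v₂ = (a₂,b₂)` in `ℍ` one has
`L(v₁ + v₂) ≤ L(v₁) + L(v₂)`; moreover `L(k·v) = k·L(v)` for every `v ∈ ℍ`
and every real `k > 0`. -/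
theorem L_triangle_inequality_and_homogeneous :
    (∀ v₁ v₂ : ℝ × ℝ, 0 < v₁.2 → 0 < v₂.2 → L (v₁ + v₂) ≤ L v₁ + L v₂) ∧
    (∀ v : ℝ × ℝ, 0 < v.2 → ∀ k : ℝ, 0 < k → L (k • v) = k * L v) := by
  exact ⟨fun _ _ h₁ h₂ => L_add_le h₁ h₂, fun _ _ _ hk => L_mul_mul hk⟩
end

section
/- Let g ≥ 2 and r ≥ 1 be integers and let d be a real number with 0 ≤ d ≤ r(g-1). Suppose β₁ < 0 < β₂ are real numbers with β₂ - β₁ ≤ 1 and Γ(β₂) - Γ(β₁) = (β₂ - β₁)·(-(g-1) + d/r). Then -1 + d/(2r(g-1)) ≤ β₁ and β₂ ≤ d/(2r(g-1)). -/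
/-- The 1-periodic function `γ` with `γ(x) = 1 - x²` for `x ∈ [-1/2, 1/2]`, `x ≠ 0`,
and `γ(0) = 0` (extended 1-periodically via `x - round x ∈ [-1/2, 1/2)`). -/
noncomputable def gam (x : ℝ) : ℝ :=
  if x - round x = 0 then 0 else 1 - (x - round x) ^ 2

/-- `Γ(x) = (g-1)x² - γ(x)` (here `2g - 2 = H²` for a genus `g` polarized K3). -/
noncomputable def Gam (g x : ℝ) : ℝ := (g - 1) * x ^ 2 - gam x

theorem gam_add_one (x : ℝ) : gam (x + 1) = gam x := by
  have h : x + 1 - round (x + 1) = x - round x := by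
    rw [round_add_one]
    push_cast
    ring
  simp only [gam, h]

theorem gam_of_abs_le_half {x : ℝ} (h0 : x ≠ 0) (h : |x| ≤ 1 / 2) : gam x = 1 - x ^ 2 := by
  obtain ⟨hl, hu⟩ := abs_le.mp h
  rcases hu.eq_or_lt with rfl | hu
  · norm_num [gam]
  · have hr : round x = 0 := round_eq_zero_iff.mpr ⟨by linarith, hu⟩
    simp [gam, hr, h0]

/-- The estimate behind the wall bounds, with `k = g - 1` and `t = d / r`. -/
theorem wall_endpoint_bounds_aux {k t a b : ℝ} (hk : 1 ≤ k) (ht : t ≤ k)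
    (ha : a < 0) (hb : 0 < b) (hlen : b - a ≤ 1)
    (h : (k * b ^ 2 - gam b) - (k * a ^ 2 - gam a) = (b - a) * (-k + t)) :
    t ≤ 2 * k * (1 + a) ∧ 2 * k * b ≤ t := by
  have hs : 0 < b - a := by linarith
  rcases le_total b (1 / 2) with hb2 | hb2
  · rw [gam_of_abs_le_half hb.ne' (abs_le.mpr ⟨by linarith, hb2⟩)] at h
    rcases le_total (-1 / 2) a with ha2 | ha2
    · rw [gam_of_abs_le_half ha.ne (abs_le.mpr ⟨by linarith, by linarith⟩)] at h
      have e : (k + 1) * (b + a) = t - k := by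
        apply mul_left_cancel₀ hs.ne'
        linear_combination h
      constructor
      · nlinarith
      · nlinarith
    · rw [← gam_add_one a, gam_of_abs_le_half (by linarith)
        (abs_le.mpr ⟨by linarith, by linarith⟩)] at h
      have e : (b - a) * (k * (1 + a + b) - t) = (1 + a - b) * (1 + a + b) := by
        linear_combination h
      constructor
      · have : 0 ≤ k * (1 + a + b) - t := by
          refine nonneg_of_mul_nonneg_right (e ▸ ?_) hs
          exact mul_nonneg (by linarith) (by linarith)
        nlinarith
      · have : 0 ≤ (b - a) * (t - 2 * k * b) := by
          have e' : (b - a) * (t - 2 * k * b)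
              = (1 + a - b) * (k * (b - a) - (1 + a + b)) := by
            linear_combination -e
          rw [e']
          exact mul_nonneg (by linarith) (by nlinarith)
        linarith [nonneg_of_mul_nonneg_right this hs]
  · have hγb : gam b = 1 - (b - 1) ^ 2 := by
      rw [← sub_add_cancel b 1, gam_add_one, gam_of_abs_le_half (by linarith)
        (abs_le.mpr ⟨by linarith, by linarith⟩), sub_add_cancel]
    rw [hγb, gam_of_abs_le_half ha.ne (abs_le.mpr ⟨by linarith, by linarith⟩)] at h
    have e : (b - a) * (k * (1 + a + b) - t) = -((1 + a - b) * (1 - a - b)) := by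
      linear_combination h
    have hle : k * (1 + a + b) - t ≤ 0 := by
      have : 0 ≤ (1 + a - b) * (1 - a - b) := mul_nonneg (by linarith) (by linarith)
      by_contra! hc
      nlinarith [mul_pos hs hc]
    have hab : a + b ≤ 0 := by
      by_contra! hc
      nlinarith
    obtain rfl : b = 1 / 2 := by linarith
    obtain rfl : a = -1 / 2 := by linarith
    constructor <;> linarith

/-- Location of the endpoints of the destabilizing wall: if `β₁ < 0 < β₂`,
`β₂ - β₁ ≤ 1` and `Γ(β₂) - Γ(β₁) = (β₂ - β₁)(-(g-1) + d/r)`, then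
`-1 + d/(2r(g-1)) ≤ β₁` and `β₂ ≤ d/(2r(g-1))`. -/
theorem wall_endpoint_bounds (g r : ℕ) (hg : 2 ≤ g) (hr : 1 ≤ r)
    (d : ℝ) (hd0 : 0 ≤ d) (hd1 : d ≤ (r : ℝ) * ((g : ℝ) - 1))
    (β₁ β₂ : ℝ) (hβ₁ : β₁ < 0) (hβ₂ : 0 < β₂)
    (hlen : β₂ - β₁ ≤ 1)
    (hslope : Gam (g : ℝ) β₂ - Gam (g : ℝ) β₁ = (β₂ - β₁) * (-((g : ℝ) - 1) + d / (r : ℝ))) :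
    -1 + d / (2 * (r : ℝ) * ((g : ℝ) - 1)) ≤ β₁ ∧
    β₂ ≤ d / (2 * (r : ℝ) * ((g : ℝ) - 1)) := by
  have hr0 : (0 : ℝ) < r := by exact_mod_cast hr
  have hk : (1 : ℝ) ≤ (g : ℝ) - 1 := by
    have : (2 : ℝ) ≤ g := by exact_mod_cast hg
    linarith
  have hk0 : (0 : ℝ) < 2 * ((g : ℝ) - 1) := by linarith
  have ht : d / r ≤ (g : ℝ) - 1 := by
    rw [div_le_iff₀ hr0]
    linarith
  obtain ⟨h₁, h₂⟩ := wall_endpoint_bounds_aux hk ht hβ₁ hβ₂ hlen hslope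
  have hq : d / (2 * (r : ℝ) * ((g : ℝ) - 1)) = d / r / (2 * ((g : ℝ) - 1)) := by
    rw [div_div]
    ring_nf
  rw [hq]
  constructor
  · have := (div_le_iff₀' hk0).mpr h₁
    linarith
  · exact (le_div_iff₀' hk0).mpr h₂
end

section
/- Let r ≥ 3 and g ≥ r² be integers and let d be a real number with 0 ≤ d ≤ 2g - 2 + r. Then (Γ(1/r) - Γ((2-r)/(r-1))) / (1/r - (2-r)/(r-1)) ≥ -(g-1) + d/r. -/
theorem gam_add_intCast {t : ℝ} (ht0 : 0 < t) (ht : t ≤ 1 / 2) (n : ℤ) :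
    gam (t + n) = 1 - t ^ 2 := by
  unfold gam
  rw [round_add_intCast, round_eq]
  rcases ht.lt_or_eq with h | rfl
  · have hfloor : ⌊t + 1 / 2⌋ = 0 := by
      rw [Int.floor_eq_iff]
      constructor <;> norm_num <;> linarith
    rw [hfloor]
    simp [ht0.ne']
  · norm_num

/-- The numerical inequality behind the slope comparison, in terms of `r` and `g`. -/
theorem slope_correction_le {r g : ℝ} (hr : 3 ≤ r) (hg : r ^ 2 ≤ g) :
    (2 * r - 1) / (r * (r - 1) * (r ^ 2 - r - 1)) + 1 ≤ (g - 1) / (r * (r - 1)) := by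
  have hr1 : 0 < r - 1 := by linarith
  have hq : 0 < r ^ 2 - r - 1 := by nlinarith
  have hr0 : 0 < r := by linarith
  have key : (2 * r - 1) / (r ^ 2 - r - 1) ≤ r - 1 := by
    rw [div_le_iff₀ hq]
    nlinarith [mul_nonneg (sub_nonneg.2 hr) hr1.le]
  calc (2 * r - 1) / (r * (r - 1) * (r ^ 2 - r - 1)) + 1
      = ((2 * r - 1) / (r ^ 2 - r - 1) + r * (r - 1)) / (r * (r - 1)) := by
        field_simp
    _ ≤ (g - 1) / (r * (r - 1)) := by
        gcongr
        nlinarith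

/-- Slope comparison: for `r ≥ 3`, `g ≥ r²` and `0 ≤ d ≤ 2g - 2 + r`, the slope of the
line through the points of `Γ` at `x = (2-r)/(r-1)` and `x = 1/r` is at least
`-(g-1) + d/r`. -/
theorem slope_comparison (r g : ℕ) (hr : 3 ≤ r) (hg : r ^ 2 ≤ g)
    (d : ℝ) (hd0 : 0 ≤ d) (hd1 : d ≤ 2 * (g : ℝ) - 2 + (r : ℝ)) :
    (Gam (g : ℝ) (1 / (r : ℝ)) - Gam (g : ℝ) ((2 - (r : ℝ)) / ((r : ℝ) - 1))) /
        (1 / (r : ℝ) - (2 - (r : ℝ)) / ((r : ℝ) - 1))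
      ≥ -((g : ℝ) - 1) + d / (r : ℝ) := by
  have hr' : (3 : ℝ) ≤ r := by exact_mod_cast hr
  have hg' : (r : ℝ) ^ 2 ≤ g := by exact_mod_cast hg
  generalize (r : ℝ) = r at *
  generalize (g : ℝ) = g at *
  have hr0 : 0 < r := by linarith
  have hr1 : 0 < r - 1 := by linarith
  have hq : 0 < r ^ 2 - r - 1 := by nlinarith
  have h₁ : gam (1 / r) = 1 - (1 / r) ^ 2 := by
    simpa using gam_add_intCast (t := 1 / r) (by positivity)
      (one_div_le_one_div_of_le two_pos (by linarith)) 0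
  have h₂ : gam ((2 - r) / (r - 1)) = 1 - (1 / (r - 1)) ^ 2 := by
    rw [← gam_add_intCast (t := 1 / (r - 1)) (by positivity)
      (one_div_le_one_div_of_le two_pos (by linarith)) (-1)]
    congr 1
    push_cast
    field_simp
    ring
  have hx : 1 / r - (2 - r) / (r - 1) = (r ^ 2 - r - 1) / (r * (r - 1)) := by
    field_simp
    ring
  have hslope : (Gam g (1 / r) - Gam g ((2 - r) / (r - 1))) / (1 / r - (2 - r) / (r - 1)) =
      -(g - 1) + 2 * (g - 1) / r + (g - 1) / (r * (r - 1)) -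
        (2 * r - 1) / (r * (r - 1) * (r ^ 2 - r - 1)) := by
    rw [Gam, Gam, h₁, h₂, hx]
    generalize hq_def : r ^ 2 - r - 1 = q at hq ⊢
    field_simp
    rw [← hq_def]
    ring
  have hd : d / r ≤ 2 * (g - 1) / r + 1 := by
    rw [div_add_one hr0.ne']
    gcongr
    linarith
  rw [hslope]
  linarith [slope_correction_le hr' hg']
end

section
/- Let g ≥ 2 and r ≥ 1 be integers and let d be a real number with 0 ≤ d ≤ r(g-1). Then (1/2)(r(1-g)+d) + (1/2)·√((g d²/(4r(g-1)²) - r)² + g d²/(g-1)²) + (1/2)·√((r(g-1) - d + g d²/(4r(g-1)²) - r)² + 4g(r - d/(2g-2))²) < r + g d²/(4r(g-1)²) + r/g. -/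
/-- The perimeter bound proving the first part of the main theorem:
`(1/2)(r(1-g)+d) + (1/2)√((gd²/(4r(g-1)²) - r)² + gd²/(g-1)²)`
`+ (1/2)√((r(g-1) - d + gd²/(4r(g-1)²) - r)² + 4g(r - d/(2g-2))²)`
`< r + gd²/(4r(g-1)²) + r/g`. -/
theorem HN_polygon_perimeter_bound (g r : ℕ) (hg : 2 ≤ g) (hr : 1 ≤ r)
    (d : ℝ) (hd0 : 0 ≤ d) (hd1 : d ≤ (r : ℝ) * ((g : ℝ) - 1)) :
    (1 / 2) * ((r : ℝ) * (1 - (g : ℝ)) + d)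
      + (1 / 2) * Real.sqrt (((g : ℝ) * d ^ 2 / (4 * (r : ℝ) * ((g : ℝ) - 1) ^ 2) - (r : ℝ)) ^ 2
          + (g : ℝ) * d ^ 2 / ((g : ℝ) - 1) ^ 2)
      + (1 / 2) * Real.sqrt (((r : ℝ) * ((g : ℝ) - 1) - d
            + (g : ℝ) * d ^ 2 / (4 * (r : ℝ) * ((g : ℝ) - 1) ^ 2) - (r : ℝ)) ^ 2
          + 4 * (g : ℝ) * ((r : ℝ) - d / (2 * (g : ℝ) - 2)) ^ 2)
      < (r : ℝ) + (g : ℝ) * d ^ 2 / (4 * (r : ℝ) * ((g : ℝ) - 1) ^ 2) + (r : ℝ) / (g : ℝ) := by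
  have hg' : (2 : ℝ) ≤ g := by exact_mod_cast hg
  have hr' : (0 : ℝ) < r := by exact_mod_cast hr
  have hg0 : (0 : ℝ) < g := by linarith
  have hh : (0 : ℝ) < (g : ℝ) - 1 := by linarith
  generalize (g : ℝ) = G at *
  generalize (r : ℝ) = R at *
  obtain ⟨s, rfl⟩ : ∃ s, d = R * (G - 1) * s :=
    ⟨d / (R * (G - 1)), by field_simp⟩
  have hRh : 0 < R * (G - 1) := mul_pos hr' hh
  have hs0 : 0 ≤ s := nonneg_of_mul_nonneg_right hd0 hRh
  have hs1 : s ≤ 1 := le_of_mul_le_mul_left (by linarith) hRh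
  have hA : G * (R * (G - 1) * s) ^ 2 / (4 * R * (G - 1) ^ 2) = R * (G * s ^ 2 / 4) := by
    field_simp
  have hB : G * (R * (G - 1) * s) ^ 2 / (G - 1) ^ 2 = R ^ 2 * (G * s ^ 2) := by
    field_simp
  have hC : R * (G - 1) * s / (2 * G - 2) = R * s / 2 := by
    have : 2 * G - 2 = 2 * (G - 1) := by ring
    rw [this]
    field_simp
  rw [hA, hB, hC]
  -- The first radicand is a perfect square.
  have hsqrt₁ : Real.sqrt ((R * (G * s ^ 2 / 4) - R) ^ 2 + R ^ 2 * (G * s ^ 2))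
      = R * (G * s ^ 2 / 4) + R := by
    rw [show (R * (G * s ^ 2 / 4) - R) ^ 2 + R ^ 2 * (G * s ^ 2)
      = (R * (G * s ^ 2 / 4) + R) ^ 2 by ring]
    exact Real.sqrt_sq (by positivity)
  -- The second radicand falls short of a square by exactly `(R * (s + 2 / G)) ^ 2`.
  have hsqrt₂ : Real.sqrt ((R * (G - 1) - R * (G - 1) * s + R * (G * s ^ 2 / 4) - R) ^ 2
      + 4 * G * (R - R * s / 2) ^ 2)
      < R * (G * s ^ 2 / 4) + R + 2 * (R / G) + R * (G - 1) * (1 - s) := by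
    have hs : 0 ≤ 1 - s := by linarith
    rw [Real.sqrt_lt' (by positivity), ← sub_pos]
    have hgap : (R * (G * s ^ 2 / 4) + R + 2 * (R / G) + R * (G - 1) * (1 - s)) ^ 2
        - ((R * (G - 1) - R * (G - 1) * s + R * (G * s ^ 2 / 4) - R) ^ 2
          + 4 * G * (R - R * s / 2) ^ 2) = (R * (s + 2 / G)) ^ 2 := by
      field_simp
      ring
    rw [hgap]
    positivity
  rw [hsqrt₁]
  linarith
end

section
/- Let r ≥ 3 and g ≥ r² be integers. Then √(((r-2)(g-1) + g/r - r)² + 4g(r-1)²) < (r-2)(g-1) + g/r + r + 2r/g. -/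
/-- Inequality (ED): for `r ≥ 3` and `g ≥ r²`,
`√(((r-2)(g-1) + g/r - r)² + 4g(r-1)²) < (r-2)(g-1) + g/r + r + 2r/g`. -/
theorem ED_inequality (r g : ℕ) (hr : 3 ≤ r) (hg : r ^ 2 ≤ g) :
    Real.sqrt ((((r : ℝ) - 2) * ((g : ℝ) - 1) + (g : ℝ) / (r : ℝ) - (r : ℝ)) ^ 2
        + 4 * (g : ℝ) * ((r : ℝ) - 1) ^ 2)
      < ((r : ℝ) - 2) * ((g : ℝ) - 1) + (g : ℝ) / (r : ℝ) + (r : ℝ) + 2 * (r : ℝ) / (g : ℝ) := by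
  have hr' : (3 : ℝ) ≤ r := by exact_mod_cast hr
  have hg' : (1 : ℝ) ≤ g := by exact_mod_cast (Nat.one_le_pow 2 r (by omega)).trans hg
  have hr0 : (0 : ℝ) < r := by linarith
  have hg0 : (0 : ℝ) < g := by linarith
  have hX : 0 ≤ ((r : ℝ) - 2) * ((g : ℝ) - 1) := mul_nonneg (by linarith) (by linarith)
  refine (Real.sqrt_lt' (by positivity)).2 (sub_pos.1 ?_)
  have key : (((r : ℝ) - 2) * ((g : ℝ) - 1) + (g : ℝ) / r + r + 2 * r / g) ^ 2
      - ((((r : ℝ) - 2) * ((g : ℝ) - 1) + (g : ℝ) / r - r) ^ 2 + 4 * g * ((r : ℝ) - 1) ^ 2)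
      = 4 + 8 * r / g + (2 * r / g) ^ 2 := by
    field_simp
    ring
  rw [key]
  positivity
end

section
/- Let r ≥ 4 and g ≥ r² be integers and let t be a real number with 5 ≤ t ≤ (r-2)(g-1). Then t/r - (2/r)·(r + (2 + t/(g-1))²·g/(4r) + r/g) + 2 + (2/r)·⌊g/r⌋ > 0. -/
/-- A concave quadratic in `u` is positive on `[a, x - 2]`, where `a = 5 / (y - 1)`. -/
lemma quadratic_pos {x y a u : ℝ} (hx : 4 ≤ x) (hy : 16 ≤ y) (ha : a * (y - 1) = 5)
    (ha0 : 0 < a) (ha1 : a ≤ 1 / 3) (hu0 : a ≤ u) (hu1 : u ≤ x - 2) :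
    0 < u * (2 * x * (y - 1) - (4 + u) * y) - 4 * x := by
  have hay : a * y = 5 + a := by linarith
  have hslope : 0 ≤ 2 * x * (y - 1) - 4 * y - y * (u + a) := by
    nlinarith [mul_le_mul_of_nonneg_right hu1 (by linarith : 0 ≤ y),
      mul_nonneg (by linarith : 0 ≤ x - 2) (by linarith : 0 ≤ y - 16)]
  have hleft : 0 < a * (2 * x * (y - 1) - (4 + a) * y) - 4 * x := by
    have h : a * (2 * x * (y - 1) - (4 + a) * y) - 4 * x = 6 * x - 20 - 9 * a - a ^ 2 := by
      linear_combination 2 * x * ha - (4 + a) * hay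
    rw [h]
    nlinarith
  linarith [mul_nonneg (sub_nonneg.2 hu0) hslope]


/-- Positivity of the concave quadratic `Q(t)` from Step 1 of the main theorem:
for `r ≥ 4`, `g ≥ r²` and `5 ≤ t ≤ (r-2)(g-1)`,
`t/r - (2/r)(r + (2 + t/(g-1))²g/(4r) + r/g) + 2 + (2/r)⌊g/r⌋ > 0`. -/
theorem Q_positive (r g : ℕ) (hr : 4 ≤ r) (hg : r ^ 2 ≤ g)
    (t : ℝ) (ht0 : 5 ≤ t) (ht1 : t ≤ ((r : ℝ) - 2) * ((g : ℝ) - 1)) :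
    t / (r : ℝ)
      - (2 / (r : ℝ)) * ((r : ℝ) + (2 + t / ((g : ℝ) - 1)) ^ 2 * (g : ℝ) / (4 * (r : ℝ))
          + (r : ℝ) / (g : ℝ))
      + 2 + (2 / (r : ℝ)) * (⌊(g : ℝ) / (r : ℝ)⌋ : ℝ) > 0 := by
  have hrR : (4 : ℝ) ≤ r := by exact_mod_cast hr
  have hgR : (r : ℝ) ^ 2 ≤ g := by exact_mod_cast hg
  have hg16 : (16 : ℝ) ≤ g := by nlinarith
  have hfloor : (g : ℝ) - r + 1 ≤ r * (⌊(g : ℝ) / (r : ℝ)⌋ : ℝ) := by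
    have h1 := Int.lt_floor_add_one ((g : ℝ) / r)
    rw [div_lt_iff₀ (by linarith)] at h1
    have h2 : (g : ℤ) < (⌊(g : ℝ) / (r : ℝ)⌋ + 1) * r := by exact_mod_cast h1
    have h3 : (g : ℤ) + 1 ≤ (⌊(g : ℝ) / (r : ℝ)⌋ + 1) * r := h2
    have h4 : (g : ℝ) + 1 ≤ ((⌊(g : ℝ) / (r : ℝ)⌋ : ℝ) + 1) * r := by exact_mod_cast h3
    linarith
  have hrg : (r : ℝ) ^ 2 / g ≤ 1 := (div_le_one (by linarith)).2 hgR
  generalize (⌊(g : ℝ) / (r : ℝ)⌋ : ℝ) = m at hfloor ⊢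
  generalize (r : ℝ) = x at *
  generalize (g : ℝ) = y at *
  have hn : 0 < y - 1 := by linarith
  have hu0 : 5 / (y - 1) ≤ t / (y - 1) := by gcongr
  have hu1 : t / (y - 1) ≤ x - 2 := (div_le_iff₀ hn).2 ht1
  have ha : 5 / (y - 1) * (y - 1) = 5 := div_mul_cancel₀ _ hn.ne'
  have ht : t = t / (y - 1) * (y - 1) := (div_mul_cancel₀ _ hn.ne').symm
  have ha0 : 0 < 5 / (y - 1) := by positivity
  have ha1 : 5 / (y - 1) ≤ 1 / 3 := (div_le_iff₀ hn).2 (by linarith)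
  have key := quadratic_pos hrR hg16 ha ha0 ha1 hu0 hu1
  have hQ : t / x - (2 / x) * (x + (2 + t / (y - 1)) ^ 2 * y / (4 * x) + x / y) + 2 + (2 / x) * m
      = (2 * x * t - (2 + t / (y - 1)) ^ 2 * y - 4 * (x ^ 2 / y) + 4 * (x * m)) / (2 * x ^ 2) := by
    have hx : x ≠ 0 := by linarith
    have hy : y ≠ 0 := by linarith
    generalize t / (y - 1) = u
    field_simp
    ring
  rw [hQ]
  apply div_pos _ (by positivity)
  generalize t / (y - 1) = u at *
  subst ht
  nlinarith
end

section
/- Let r ≥ 4 and g ≥ r² be integers and let d be a real number with 0 ≤ d ≤ 2(g-1) - 2(⌊g/r⌋ - r) - 1. Then d + r(1-g) + √(16g + (d - 2(g-1) - (r-2)(g+r)/r)²) + ((r-2)/(r-1))·√(((r-2)(g-1) + g/r - r)² + 4g(r-1)²) < 4r. -/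
/-- The bound `k(d) < 4r` from Step 3 of the main theorem: for `r ≥ 4`, `g ≥ r²`
and `0 ≤ d ≤ 2(g-1) - 2(⌊g/r⌋ - r) - 1`,
`d + r(1-g) + √(16g + (d - 2(g-1) - (r-2)(g+r)/r)²)`
`+ ((r-2)/(r-1))√(((r-2)(g-1) + g/r - r)² + 4g(r-1)²) < 4r`. -/
theorem kd_bound (r g : ℕ) (hr : 4 ≤ r) (hg : r ^ 2 ≤ g)
    (d : ℝ) (hd0 : 0 ≤ d)
    (hd1 : d ≤ 2 * ((g : ℝ) - 1) - 2 * ((⌊(g : ℝ) / (r : ℝ)⌋ : ℝ) - (r : ℝ)) - 1) :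
    d + (r : ℝ) * (1 - (g : ℝ))
      + Real.sqrt (16 * (g : ℝ)
          + (d - 2 * ((g : ℝ) - 1) - ((r : ℝ) - 2) * ((g : ℝ) + (r : ℝ)) / (r : ℝ)) ^ 2)
      + (((r : ℝ) - 2) / ((r : ℝ) - 1)) * Real.sqrt
          ((((r : ℝ) - 2) * ((g : ℝ) - 1) + (g : ℝ) / (r : ℝ) - (r : ℝ)) ^ 2
            + 4 * (g : ℝ) * ((r : ℝ) - 1) ^ 2)
      < 4 * (r : ℝ) := by
  have hr' : (4 : ℝ) ≤ r := by exact_mod_cast hr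
  have hg' : (r : ℝ) ^ 2 ≤ g := by exact_mod_cast hg
  have hfl : (g : ℝ) / r < ⌊(g : ℝ) / (r : ℝ)⌋ + 1 := Int.lt_floor_add_one _
  generalize (⌊(g : ℝ) / (r : ℝ)⌋ : ℝ) = n at hd1 hfl
  generalize (r : ℝ) = R at *
  generalize (g : ℝ) = G at *
  have hR0 : R ≠ 0 := by linarith
  obtain ⟨u, rfl⟩ : ∃ u, G = R * u := ⟨G / R, by field_simp⟩
  have hu : R ≤ u := by nlinarith
  have hdiv : R * u / R = u := by field_simp
  have hdiv' : (R - 2) * (R * u + R) / R = (R - 2) * (u + 1) := by field_simp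
  rw [hdiv] at hfl ⊢
  rw [hdiv']
  obtain ⟨t, ht, rfl⟩ : ∃ t, 0 ≤ t ∧ d = 2 * (R * u) - 2 - 2 * u + 2 * R + 1 - t :=
    ⟨2 * (R * u) - 2 - 2 * u + 2 * R + 1 - d, by linarith, by ring⟩
  have hfirst : √(16 * (R * u) + (2 * (R * u) - 2 - 2 * u + 2 * R + 1 - t
      - 2 * (R * u - 1) - (R - 2) * (u + 1)) ^ 2) < R * u + R - 1 + t := by
    rw [Real.sqrt_lt' (by nlinarith)]
    nlinarith [mul_nonneg ht (by linarith : (0 : ℝ) ≤ R),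
      mul_nonneg (by nlinarith : 0 ≤ R * u - 16) (by linarith : 0 ≤ R - 4)]
  have hsecond : (R - 2) / (R - 1) * √(((R - 2) * (R * u - 1) + u - R) ^ 2
      + 4 * (R * u) * (R - 1) ^ 2) ≤ (R - 2) * (R - 1) * u + 2 := by
    have hfactor : ((R - 2) * (R * u - 1) + u - R) ^ 2 + 4 * (R * u) * (R - 1) ^ 2
        = (R - 1) ^ 2 * (((R - 1) * u) ^ 2 + 4 * u + 4) := by ring
    rw [hfactor, Real.sqrt_mul (sq_nonneg _), Real.sqrt_sq (by linarith), ← mul_assoc,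
      div_mul_cancel₀ _ (by linarith)]
    have hle : √(((R - 1) * u) ^ 2 + 4 * u + 4) ≤ (R - 1) * u + 2 / (R - 2) := by
      have hpos : 0 < 2 / (R - 2) := div_pos two_pos (by linarith)
      have hmul : 2 / (R - 2) * (R - 2) = 2 := div_mul_cancel₀ _ (by linarith)
      generalize 2 / (R - 2) = w at *
      refine Real.sqrt_le_iff.mpr ⟨by nlinarith, ?_⟩
      have hwu : w * (R - 2) ≤ w * u := mul_le_mul_of_nonneg_left (by linarith) hpos.le
      have hcross : (R - 1) * u * w = 2 * u + w * u := by linear_combination u * hmul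
      nlinarith [sq_nonneg w]
    calc (R - 2) * √(((R - 1) * u) ^ 2 + 4 * u + 4)
        ≤ (R - 2) * ((R - 1) * u + 2 / (R - 2)) :=
          mul_le_mul_of_nonneg_left hle (by linarith)
      _ = (R - 2) * (R - 1) * u + 2 := by
          have : R - 2 ≠ 0 := by linarith
          field_simp
  nlinarith
end

section
/- Let g ≥ 9 be an integer with g ≠ 11. Then ⌊2√((g/3 - 1)² + g) + √((g-5)² + 16g)⌋ ≤ g + 2⌊g/3⌋ + 5. (For g = 11 this inequality fails.) -/
/-- If `g = 3 * k + r` with `0 ≤ r < 3`, then `⌊g / 3⌋ = k`. -/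
theorem floor_div_three {g k r : ℤ} (hg : g = 3 * k + r) (h0 : 0 ≤ r) (h3 : r < 3) :
    ⌊(g : ℝ) / 3⌋ = k := by
  have h0' : (0 : ℝ) ≤ r := by exact_mod_cast h0
  have h3' : (r : ℝ) < 3 := by exact_mod_cast h3
  rw [Int.floor_eq_iff, hg]
  push_cast
  constructor <;> linarith

/-- An upper bound for `√((x/3 - 1)² + x) = √((x/3 + 1/2)² + 3/4)`. -/
theorem sqrt_third_sub_one_sq_add_le {x c : ℝ} (hx : 0 ≤ x) (hc : 0 ≤ c)
    (h : 3 / 4 ≤ 2 * c * (x / 3 + 1 / 2)) :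
    √((x / 3 - 1) ^ 2 + x) ≤ x / 3 + 1 / 2 + c :=
  Real.sqrt_le_iff.mpr ⟨by positivity, by nlinarith [sq_nonneg c]⟩

/-- An upper bound for `√((x - 5)² + 16x) = √((x + 3)² + 16)`. -/
theorem sqrt_sub_five_sq_add_le {x c : ℝ} (hx : 0 ≤ x) (hc : 0 ≤ c) (h : 16 ≤ 2 * c * (x + 3)) :
    √((x - 5) ^ 2 + 16 * x) ≤ x + 3 + c :=
  Real.sqrt_le_iff.mpr ⟨by positivity, by nlinarith [sq_nonneg c]⟩

/-- The floor inequality used in the rank 3 case: for every integer `g ≥ 9` with `g ≠ 11`,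
`⌊2√((g/3 - 1)² + g) + √((g-5)² + 16g)⌋ ≤ g + 2⌊g/3⌋ + 5`; for `g = 11` this fails. -/
theorem rank3_floor_inequality :
    (∀ g : ℤ, 9 ≤ g → g ≠ 11 →
      ⌊2 * Real.sqrt (((g : ℝ) / 3 - 1) ^ 2 + (g : ℝ))
          + Real.sqrt (((g : ℝ) - 5) ^ 2 + 16 * (g : ℝ))⌋
        ≤ g + 2 * ⌊(g : ℝ) / 3⌋ + 5) ∧
    ¬ (⌊2 * Real.sqrt (((11 : ℝ) / 3 - 1) ^ 2 + (11 : ℝ))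
          + Real.sqrt (((11 : ℝ) - 5) ^ 2 + 16 * (11 : ℝ))⌋
        ≤ 11 + 2 * ⌊(11 : ℝ) / 3⌋ + 5) := by
  refine ⟨fun g hg hne => ?_, ?_⟩
  · obtain ⟨k, r, hk, h0, h3⟩ : ∃ k r : ℤ, g = 3 * k + r ∧ 0 ≤ r ∧ r < 3 :=
      ⟨g / 3, g % 3, by omega, by omega, by omega⟩
    rw [floor_div_three hk h0 h3, ← Int.lt_add_one_iff, Int.floor_lt]
    have hgk : (g : ℝ) = 3 * k + r := by exact_mod_cast hk
    push_cast
    obtain hr | hr : r ≤ 1 ∨ r = 2 := by omega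
    · have hg' : (9 : ℝ) ≤ g := by exact_mod_cast hg
      have hr' : (r : ℝ) ≤ 1 := by exact_mod_cast hr
      have h₁ := sqrt_third_sub_one_sq_add_le (x := g) (c := 3 / 20) (by linarith)
        (by norm_num) (by linarith)
      have h₂ := sqrt_sub_five_sq_add_le (x := g) (c := 2 / 3) (by linarith) (by norm_num) (by linarith)
      linarith
    · have hg' : (14 : ℝ) ≤ g := by exact_mod_cast (show 14 ≤ g by omega)
      have hr' : (r : ℝ) = 2 := by exact_mod_cast hr
      have h₁ := sqrt_third_sub_one_sq_add_le (x := g) (c := 3 / 40) (by linarith)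
        (by norm_num) (by linarith)
      have h₂ := sqrt_sub_five_sq_add_le (x := g) (c := 1 / 2) (by linarith) (by norm_num) (by linarith)
      linarith
  · have hfloor : ⌊(11 : ℝ) / 3⌋ = 3 := by norm_num [Int.floor_eq_iff]
    rw [hfloor, not_le, ← Int.add_one_le_iff, Int.le_floor]
    have h₁ : (17 / 4 : ℝ) ≤ √((11 / 3 - 1) ^ 2 + 11) := Real.le_sqrt_of_sq_le (by norm_num)
    have h₂ : (29 / 2 : ℝ) ≤ √((11 - 5) ^ 2 + 16 * 11) := Real.le_sqrt_of_sq_le (by norm_num)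
    push_cast
    linarith
end

section
/- Let g ≥ 4 be a real number and let d, s be real numbers with d ≤ 2(g-1), s ≤ d - 3g/2, and s > d/2 - g + 1. Then |s| ≤ g/2 - 2 and -g + 1 + d/2 + (1/2)·(√(4g + s²) + √(4g + (2(g-1) - d + s)²)) ≤ -g/2 + 3 + d/2. -/
/-- On the interval `|x| ≤ g/2 - 2` the function `√(4g + x²)` is at most its value `g/2 + 2` at
the endpoints. -/
theorem sqrt_four_mul_add_sq_le {g x : ℝ} (hx : |x| ≤ g / 2 - 2) :
    Real.sqrt (4 * g + x ^ 2) ≤ g / 2 + 2 := by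
  have h0 := abs_nonneg x
  have hsq : x ^ 2 ≤ (g / 2 - 2) ^ 2 := sq_le_sq' (abs_le.mp hx).1 (abs_le.mp hx).2
  exact Real.sqrt_le_iff.mpr ⟨by linarith, by linarith⟩

/-- The numerical estimate in the rank 2 case: if `g ≥ 4`, `d ≤ 2(g-1)`,
`s ≤ d - 3g/2` and `s > d/2 - g + 1`, then `|s| ≤ g/2 - 2` and
`-g + 1 + d/2 + (1/2)(√(4g + s²) + √(4g + (2(g-1) - d + s)²)) ≤ -g/2 + 3 + d/2`. -/
theorem rank2_estimate (g d s : ℝ) (hg : 4 ≤ g) (hd : d ≤ 2 * (g - 1))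
    (hs1 : s ≤ d - 3 * g / 2) (hs2 : s > d / 2 - g + 1) :
    |s| ≤ g / 2 - 2 ∧
    -g + 1 + d / 2 + (1 / 2) * (Real.sqrt (4 * g + s ^ 2)
        + Real.sqrt (4 * g + (2 * (g - 1) - d + s) ^ 2))
      ≤ -g / 2 + 3 + d / 2 := by
  have hs : |s| ≤ g / 2 - 2 := abs_le.mpr ⟨by linarith, by linarith⟩
  have ht : |2 * (g - 1) - d + s| ≤ g / 2 - 2 := abs_le.mpr ⟨by linarith, by linarith⟩
  refine ⟨hs, ?_⟩
  linarith [sqrt_four_mul_add_sq_le hs, sqrt_four_mul_add_sq_le ht]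
end
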